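/- Let (X, d) be a metric space and T : X → X a nonexpansive map. For every u ∈ X and every v ∈ ω(u), one has ω(u) ⊆ ω(v); in particular every element of ω(u) is a recurrent point of T. -/

import Mathlib

/-- The ω-limit set of a point `u` under iteration of `T`: the set of points `w` such that
for every `ε > 0` and every `N` there exists `k ≥ N` with `dist (T^[k] u) w < ε`. -/
def omegaLimitSet {X : Type*} [MetricSpace X] (T : X → X) (u : X) : Set X :=
  {w | ∀ ε > (0 : ℝ), ∀ N : ℕ, ∃ k ≥ N, dist (T^[k] u) w < ε}

/-- Iterates of a nonexpansive map are nonexpansive. -/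
theorem dist_iterate_le_of_nonexpansive {X : Type*} [MetricSpace X] {T : X → X}
    (hT : ∀ a b : X, dist (T a) (T b) ≤ dist a b) (n : ℕ) (a b : X) :
    dist (T^[n] a) (T^[n] b) ≤ dist a b := by
  induction n generalizing a b with
  | zero => exact le_rfl
  | succ n ih => exact (ih (T a) (T b)).trans (hT a b)

/-- For a nonexpansive map, `ω(u) ⊆ ω(v)` whenever `v ∈ ω(u)`. -/
theorem omegaLimitSet_subset_of_mem {X : Type*} [MetricSpace X] {T : X → X}
    (hT : ∀ a b : X, dist (T a) (T b) ≤ dist a b) {u v : X} (hv : v ∈ omegaLimitSet T u) :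
    omegaLimitSet T u ⊆ omegaLimitSet T v := by
  intro w hw ε hε N
  obtain ⟨j, -, hj⟩ := hv (ε / 2) (half_pos hε) 0
  obtain ⟨k, hk, hkw⟩ := hw (ε / 2) (half_pos hε) (N + j)
  obtain ⟨m, rfl⟩ : ∃ m, k = m + j := ⟨k - j, by omega⟩
  refine ⟨m, by omega, ?_⟩
  rw [Function.iterate_add_apply] at hkw
  have hmv := dist_iterate_le_of_nonexpansive hT m v (T^[j] u)
  rw [dist_comm v] at hmv
  linarith [dist_triangle (T^[m] v) (T^[m] (T^[j] u)) w]

/-- For a nonexpansive map `T` on a metric space, for every `u` and every `v ∈ ω(u)` one has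
`ω(u) ⊆ ω(v)`; in particular every element of `ω(u)` is a recurrent point of `T`. -/
theorem omegaLimit_subset_omegaLimit_of_nonexpansive {X : Type*} [MetricSpace X] (T : X → X)
    (hT : ∀ a b : X, dist (T a) (T b) ≤ dist a b) (u v : X) (hv : v ∈ omegaLimitSet T u) :
    omegaLimitSet T u ⊆ omegaLimitSet T v ∧
      ∀ w ∈ omegaLimitSet T u, w ∈ omegaLimitSet T w :=
  ⟨omegaLimitSet_subset_of_mem hT hv, fun _ hw => omegaLimitSet_subset_of_mem hT hw hw⟩
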